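/- A hybrid relational Hoare triple yields a unary Hoare triple for the second program: for every step relation R on a state type Σ, step functions fn0 fn1 : Σ → ℕ, relational conditions Pr Qr : Set (Σ × Σ), relational frame Fr : Set ((Σ × Σ) × (Σ × Σ)), and unary conditions P Q : Set Σ with unary frame F : Set (Σ × Σ), if (1) ensures2 R fn0 fn1 Pr Qr Fr holds, (2) for every s1 ∈ P there exists s0 with (s0, s1) ∈ Pr, (3) for all s0 s1 with (s0, s1) ∈ Qr one has s1 ∈ Q, and (4) there exists F' : Set (Σ × Σ) such that for all s0 s1 s0' s1', ((s0, s1), (s0', s1')) ∈ Fr if and only if (s0, s0') ∈ F' and (s1, s1') ∈ F, then ensuresN R fn1 P Q F holds. -/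

import Mathlib

universe u

variable {σ : Type u}

/-- n-fold composition of a step relation. -/
def relIter (R : σ → σ → Prop) : ℕ → σ → σ → Prop
  | 0, s, s' => s = s'
  | n + 1, s, s'' => ∃ s', R s s' ∧ relIter R n s' s''

/-- The `eventually` operator, defined inductively. -/
inductive EventuallyRel (R : σ → σ → Prop) (Q : Set σ) : σ → Prop
  | base {s : σ} : s ∈ Q → EventuallyRel R Q s
  | step {s : σ} : (∃ s', R s s') → (∀ s', R s s' → EventuallyRel R Q s') →
      EventuallyRel R Q s

/-- The set of states from which `Q` eventually holds. -/
def eventually (R : σ → σ → Prop) (Q : Set σ) : Set σ := {s | EventuallyRel R Q s}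

/-- The stronger eventually operator with an explicit number of steps. -/
def eventuallyN (R : σ → σ → Prop) (n : ℕ) (Q : Set σ) : Set σ :=
  {s | (∀ s', relIter R n s s' → s' ∈ Q) ∧
       (∀ l, l < n → ∀ s', relIter R l s s' → ∃ s'', R s' s'')}

/-- Ordinary unary Hoare triple. -/
def ensures (R : σ → σ → Prop) (P Q : Set σ) (F : Set (σ × σ)) : Prop :=
  ∀ s ∈ P, s ∈ eventually R {s' | s' ∈ Q ∧ (s, s') ∈ F}

/-- Stronger unary Hoare triple with a step function. -/
def ensuresN (R : σ → σ → Prop) (fn : σ → ℕ) (P Q : Set σ) (F : Set (σ × σ)) : Prop :=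
  ∀ s ∈ P, s ∈ eventuallyN R (fn s) {s' | s' ∈ Q ∧ (s, s') ∈ F}

/-- Relational Hoare triple. -/
def ensures2 (R : σ → σ → Prop) (fn0 fn1 : σ → ℕ) (P Q : Set (σ × σ))
    (F : Set ((σ × σ) × (σ × σ))) : Prop :=
  ∀ s0 s1, (s0, s1) ∈ P →
    s0 ∈ eventuallyN R (fn0 s0) {s0' | s1 ∈ eventuallyN R (fn1 s1)
      {s1' | (s0', s1') ∈ Q ∧ ((s0, s1), (s0', s1')) ∈ F}}

/-- A run that cannot get stuck before `n` steps reaches some state after exactly `n` steps. -/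
theorem exists_relIter_of_forall_lt {R : σ → σ → Prop} {n : ℕ} {s : σ}
    (h : ∀ l, l < n → ∀ s', relIter R l s s' → ∃ s'', R s' s'') :
    ∃ s', relIter R n s s' := by
  induction n generalizing s with
  | zero => exact ⟨s, rfl⟩
  | succ n ih =>
    obtain ⟨t, hst⟩ := h 0 n.succ_pos s rfl
    obtain ⟨u, htu⟩ := ih fun l hl s' hs' => h (l + 1) (Nat.succ_lt_succ hl) s' ⟨t, hst, hs'⟩
    exact ⟨u, t, hst, htu⟩

/-- If `Q` holds eventually after `n` steps, some state satisfies `Q`. -/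
theorem nonempty_of_mem_eventuallyN {R : σ → σ → Prop} {n : ℕ} {Q : Set σ} {s : σ}
    (h : s ∈ eventuallyN R n Q) : Q.Nonempty :=
  let ⟨s', hs'⟩ := exists_relIter_of_forall_lt h.2
  ⟨s', h.1 s' hs'⟩

/-- `eventuallyN` is monotone in its postcondition. -/
theorem eventuallyN_mono {R : σ → σ → Prop} {n : ℕ} {Q Q' : Set σ} (h : Q ⊆ Q') :
    eventuallyN R n Q ⊆ eventuallyN R n Q' :=
  fun _ hs => ⟨fun s' hs' => h (hs.1 s' hs'), hs.2⟩

theorem hybrid_imp_ensuresN (R : σ → σ → Prop) (fn0 fn1 : σ → ℕ)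
    (Pr Qr : Set (σ × σ)) (Fr : Set ((σ × σ) × (σ × σ)))
    (P Q : Set σ) (F : Set (σ × σ))
    (h1 : ensures2 R fn0 fn1 Pr Qr Fr)
    (h2 : ∀ s1 ∈ P, ∃ s0, (s0, s1) ∈ Pr)
    (h3 : ∀ s0 s1, (s0, s1) ∈ Qr → s1 ∈ Q)
    (h4 : ∃ F' : Set (σ × σ), ∀ s0 s1 s0' s1',
      ((s0, s1), (s0', s1')) ∈ Fr ↔ (s0, s0') ∈ F' ∧ (s1, s1') ∈ F) :
    ensuresN R fn1 P Q F := by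
  obtain ⟨F', hF⟩ := h4
  intro s1 hs1
  obtain ⟨s0, hs0⟩ := h2 s1 hs1
  obtain ⟨s0', hs0'⟩ := nonempty_of_mem_eventuallyN (h1 s0 s1 hs0)
  refine eventuallyN_mono ?_ hs0'
  rintro s1' ⟨hq, hf⟩
  exact ⟨h3 s0' s1' hq, ((hF s0 s1 s0' s1').1 hf).2⟩
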